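/- Let (ξ_n)_{n≥1} be an exponentially mixing stationary process with values in a compact metric space X whose common distribution μ is Ahlfors s-regular, and let (r_n)_{n≥1} be positive reals decreasing to 0. Then almost surely the random covering set E = limsup_{n→∞} B(ξ_n, r_n) is a set of second category in X (i.e. E is not meager). -/

import Mathlib

open MeasureTheory Metric Filter

/-- A Borel (probability) measure `μ` on a metric space is *Ahlfors `s`-regular* if there is a
constant `0 < C < ∞` with `C⁻¹ r^s ≤ μ (B(x,r)) ≤ C r^s` for all `x` and `0 < r ≤ diam X`. -/
def IsAhlforsRegular {X : Type*} [MetricSpace X] [MeasurableSpace X]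
    (μ : Measure X) (s : ℝ) : Prop :=
  ∃ C : ℝ, 0 < C ∧ ∀ (x : X) (r : ℝ), 0 < r → r ≤ diam (Set.univ : Set X) →
    ENNReal.ofReal (C⁻¹ * r ^ s) ≤ μ (ball x r) ∧ μ (ball x r) ≤ ENNReal.ofReal (C * r ^ s)

/-- A process `(ξ n)` is *stationary* if for every `k` the joint law of `(ξ (n+k))_n`
coincides with the joint law of `(ξ n)_n`. -/
def IsStationaryProcess {Ω X : Type*} [MeasurableSpace Ω] [MeasurableSpace X]
    (P : Measure Ω) (ξ : ℕ → Ω → X) : Prop :=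
  ∀ k : ℕ, Measure.map (fun ω (n : ℕ) => ξ (n + k) ω) P
    = Measure.map (fun ω (n : ℕ) => ξ n ω) P

/-- A process `(ξ n)` is *exponentially mixing* (with constants `c > 0`, `0 < γ < 1`) if for
every `n ≥ 1`, every ball `A = B(y,ρ)` and every event `D` in the σ-field generated by
`(ξ (n+i))_{i ≥ 1}` with `P D > 0`, one has `|P(ξ 1 ∈ A | D) - P(ξ 1 ∈ A)| ≤ c γ^n`. -/
def IsExpMixingProcess {Ω X : Type*} [MeasurableSpace Ω] [MetricSpace X] [MeasurableSpace X]
    (P : Measure Ω) (ξ : ℕ → Ω → X) (c γ : ℝ) : Prop :=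
  ∀ n : ℕ, 1 ≤ n → ∀ (y : X) (ρ : ℝ) (D : Set Ω),
    MeasurableSet[⨆ i : ℕ, MeasurableSpace.comap (ξ (n + 1 + i)) inferInstance] D →
    0 < P D →
    |(P ({ω | ξ 1 ω ∈ ball y ρ} ∩ D)).toReal / (P D).toReal
      - (P {ω | ξ 1 ω ∈ ball y ρ}).toReal| ≤ c * γ ^ n

theorem ahlfors_ball_pos {X : Type*} [MetricSpace X] [CompactSpace X]
    [MeasurableSpace X] [BorelSpace X] (μ : Measure X) [IsProbabilityMeasure μ]
    (s : ℝ) (hreg : IsAhlforsRegular μ s) (x : X) (ρ : ℝ) (hρ : 0 < ρ) :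
    0 < μ (ball x ρ) := by
  obtain ⟨C, hC, h⟩ := hreg
  rcases (diam_nonneg (s := (Set.univ : Set X))).eq_or_lt with hd | hd
  · have hu : ball x ρ = Set.univ := by
      refine Set.eq_univ_of_forall fun y => ?_
      have := dist_le_diam_of_mem (isCompact_univ (X := X)).isBounded
        (Set.mem_univ y) (Set.mem_univ x)
      rw [mem_ball]
      linarith
    rw [hu]
    simp
  · have hm : 0 < min ρ (diam (Set.univ : Set X)) := lt_min hρ hd
    have h1 := (h x _ hm (min_le_right _ _)).1
    refine lt_of_lt_of_le ?_ (h1.trans (measure_mono (ball_subset_ball (min_le_left _ _))))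
    rw [ENNReal.ofReal_pos]
    exact mul_pos (inv_pos.2 hC) (Real.rpow_pos_of_pos hm s)

theorem avoid_null {Ω X : Type*} [MeasurableSpace Ω] [MetricSpace X]
    [MeasurableSpace X] [BorelSpace X]
    (P : Measure Ω) [IsProbabilityMeasure P]
    (ξ : ℕ → Ω → X) (hmeas : ∀ n, Measurable (ξ n))
    (hstat : IsStationaryProcess P ξ)
    (c γ : ℝ) (hγ0 : 0 < γ) (hγ1 : γ < 1)
    (hmix : IsExpMixingProcess P ξ c γ) (y : X) (ρ : ℝ)
    (hA : 0 < P {ω | ξ 1 ω ∈ ball y ρ}) (N : ℕ) :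
    P {ω | ∀ n, ξ (n + N) ω ∉ ball y ρ} = 0 := by
  have hS : MeasurableSet {f : ℕ → X | ∀ n, f n ∉ ball y ρ} := by
    have : {f : ℕ → X | ∀ n, f n ∉ ball y ρ} = ⋂ n, (fun f : ℕ → X => f n) ⁻¹' (ball y ρ)ᶜ := by
      ext f; simp
    rw [this]
    exact MeasurableSet.iInter fun n => measurable_pi_apply n measurableSet_ball.compl
  have hm : ∀ k, Measurable (fun ω (n : ℕ) => ξ (n + k) ω) := fun k =>
    measurable_pi_lambda _ fun n => hmeas _
  have hDm : ∀ k, MeasurableSet {ω | ∀ n, ξ (n + k) ω ∉ ball y ρ} := fun k => hm k hS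
  have hD : ∀ k, P {ω | ∀ n, ξ (n + k) ω ∉ ball y ρ} = P {ω | ∀ n, ξ n ω ∉ ball y ρ} := by
    intro k
    have h := congrArg (fun ν => ν {f : ℕ → X | ∀ n, f n ∉ ball y ρ}) (hstat k)
    rw [Measure.map_apply (hm k) hS, Measure.map_apply (measurable_pi_lambda _ hmeas) hS] at h
    exact h
  by_contra hne
  rw [hD N] at hne
  have hz : ∀ k, P ({ω | ξ 1 ω ∈ ball y ρ} ∩ {ω | ∀ n, ξ (n + (k + 1)) ω ∉ ball y ρ}) = 0 := by
    intro k
    have hsub : {ω | ξ 1 ω ∈ ball y ρ} ∩ {ω | ∀ n, ξ (n + (k + 1)) ω ∉ ball y ρ} ⊆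
        {ω | ∀ n, ξ (n + (k + 1)) ω ∉ ball y ρ} \ {ω | ∀ n, ξ (n + 1) ω ∉ ball y ρ} := by
      rintro ω ⟨h1, h2⟩
      exact ⟨h2, fun h3 => h3 0 h1⟩
    refine measure_mono_null hsub ?_
    rw [measure_sdiff _ (hDm 1).nullMeasurableSet (measure_ne_top _ _), hD, hD, tsub_self]
    intro ω h n
    have := h (n + k)
    rwa [add_assoc] at this
  have hle : ∀ k : ℕ, (P {ω | ξ 1 ω ∈ ball y ρ}).toReal ≤ c * γ ^ (k + 1) := by
    intro k
    have h := hmix (k + 1) (by omega) y ρ {ω | ∀ n, ξ (n + (k + 1 + 1)) ω ∉ ball y ρ} ?_ ?_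
    · rw [hz (k + 1)] at h
      simp only [ENNReal.toReal_zero, zero_div, zero_sub, abs_neg] at h
      exact (le_abs_self _).trans h
    · have : {ω | ∀ n, ξ (n + (k + 1 + 1)) ω ∉ ball y ρ}
          = ⋂ n, ξ (k + 1 + 1 + n) ⁻¹' (ball y ρ)ᶜ := by
        ext ω; simp [add_comm]
      rw [this]
      refine MeasurableSet.iInter fun n => ?_
      exact (le_iSup (fun i : ℕ => MeasurableSpace.comap (ξ (k + 1 + 1 + i)) inferInstance) n) _
        ⟨_, measurableSet_ball.compl, rfl⟩
    · rw [hD]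
      exact pos_iff_ne_zero.2 hne
  have hlim : Tendsto (fun k : ℕ => c * γ ^ (k + 1)) atTop (nhds (c * 0)) :=
    ((tendsto_pow_atTop_nhds_zero_of_lt_one hγ0.le hγ1).comp (tendsto_add_atTop_nat 1)).const_mul c
  have h0 := ge_of_tendsto' hlim hle
  rw [mul_zero] at h0
  exact absurd h0 (not_le.2 (ENNReal.toReal_pos hA.ne' (measure_ne_top _ _)))

/-- Theorem 4, second category part. If `(ξ n)` is an exponentially mixing
stationary process whose common distribution `μ` is Ahlfors `s`-regular and `(r n)` decreases
to `0`, then almost surely the random covering set `E = limsup B(ξ n, r n)` is a set of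
second category in `X`, i.e. it is not meager. -/
theorem random_covering_second_category
    {Ω X : Type*} [MeasurableSpace Ω] [MetricSpace X] [CompactSpace X]
    [MeasurableSpace X] [BorelSpace X]
    (P : Measure Ω) [IsProbabilityMeasure P]
    (ξ : ℕ → Ω → X) (hmeas : ∀ n, Measurable (ξ n))
    (μ : Measure X) [IsProbabilityMeasure μ] (hdist : Measure.map (ξ 1) P = μ)
    (s : ℝ) (hs : 0 < s) (hreg : IsAhlforsRegular μ s)
    (hstat : IsStationaryProcess P ξ)
    (c γ : ℝ) (hc : 0 < c) (hγ0 : 0 < γ) (hγ1 : γ < 1)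
    (hmix : IsExpMixingProcess P ξ c γ)
    (r : ℕ → ℝ) (hpos : ∀ n, 0 < r n) (hanti : Antitone r)
    (hlim : Tendsto r atTop (nhds 0)) :
    ∀ᵐ ω ∂P, ¬ IsMeagre (Filter.limsup (fun n => ball (ξ n ω) (r n)) atTop) := by
  have hne : Nonempty X := μ.nonempty_of_neZero
  have key : ∀ᵐ ω ∂P, ∀ (k m N : ℕ),
      ∃ n, ξ (n + N) ω ∈ ball (TopologicalSpace.denseSeq X k) (1 / ((m : ℝ) + 1)) := by
    rw [ae_all_iff]; intro k
    rw [ae_all_iff]; intro m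
    rw [ae_all_iff]; intro N
    have hA : 0 < P {ω | ξ 1 ω ∈ ball (TopologicalSpace.denseSeq X k) (1 / ((m : ℝ) + 1))} := by
      have h := ahlfors_ball_pos μ s hreg (TopologicalSpace.denseSeq X k) (1 / ((m : ℝ) + 1))
        Nat.one_div_pos_of_nat
      rw [← hdist, Measure.map_apply (hmeas 1) measurableSet_ball] at h
      exact h
    have h := avoid_null P ξ hmeas hstat c γ hγ0 hγ1 hmix _ _ hA N
    rw [ae_iff]
    simpa only [not_exists] using h
  filter_upwards [key] with ω hω
  have hE : limsup (fun n => ball (ξ n ω) (r n)) atTop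
      = ⋂ N : ℕ, ⋃ n : ℕ, ball (ξ (n + N) ω) (r (n + N)) := by
    rw [limsup_eq_iInf_iSup_of_nat']
    rfl
  have hopen : ∀ N : ℕ, IsOpen (⋃ n : ℕ, ball (ξ (n + N) ω) (r (n + N))) := fun N =>
    isOpen_iUnion fun n => isOpen_ball
  rw [hE]
  refine not_isMeagre_of_isGδ_of_dense (IsGδ.iInter_of_isOpen hopen)
    (dense_iInter_of_isOpen hopen fun N => ?_)
  rw [Metric.dense_iff]
  intro x ε hε
  obtain ⟨m, hm⟩ := exists_nat_one_div_lt (half_pos hε)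
  obtain ⟨k, hk⟩ := (TopologicalSpace.denseRange_denseSeq X).exists_dist_lt x (half_pos hε)
  obtain ⟨n, hn⟩ := hω k m N
  refine ⟨ξ (n + N) ω, ?_, Set.mem_iUnion.2 ⟨n, mem_ball_self (hpos _)⟩⟩
  rw [mem_ball] at hn ⊢
  have := dist_triangle (ξ (n + N) ω) (TopologicalSpace.denseSeq X k) x
  rw [dist_comm x] at hk
  linarith
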